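/- Let L be a free ℤ-module of finite rank equipped with a symmetric ℤ-bilinear form B that is even, nondegenerate, and neither positive definite nor negative definite. Then for every nonzero α ∈ L with B(α,α) = 0 there exists β ∈ L such that B(β,β) < 0 and B(α,β) < 0; consequently B(α+2β, α+2β) is a negative even integer. -/

import Mathlib

/-- Let `L` be a free ℤ-module of finite rank with a symmetric ℤ-bilinear form
`B` that is even, nondegenerate, and neither positive nor negative definite. Then for every
nonzero isotropic `α ∈ L` there is `β ∈ L` with `B β β < 0`, `B α β < 0`, and
`B (α+2β) (α+2β)` a negative even integer. -/
theorem stmt2 (L : Type*) [AddCommGroup L] [Module ℤ L]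
    [Module.Free ℤ L] [Module.Finite ℤ L]
    (B : L →ₗ[ℤ] L →ₗ[ℤ] ℤ)
    (hsymm : ∀ x y : L, B x y = B y x)
    (heven : ∀ x : L, Even (B x x))
    (hnondeg : ∀ x : L, (∀ y : L, B x y = 0) → x = 0)
    (hnotpos : ¬ (∀ x : L, x ≠ 0 → 0 < B x x))
    (hnotneg : ¬ (∀ x : L, x ≠ 0 → B x x < 0))
    (α : L) (hα : α ≠ 0) (hiso : B α α = 0) :
    ∃ β : L, B β β < 0 ∧ B α β < 0 ∧
      B (α + 2 • β) (α + 2 • β) < 0 ∧ Even (B (α + 2 • β) (α + 2 • β)) := by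
  have h1 : ∃ y, B α y < 0 := by
    by_contra hcon
    push Not at hcon
    apply hα
    apply hnondeg
    intro y
    have h := hcon y
    have h' := hcon (-y)
    rw [map_neg] at h'
    omega
  obtain ⟨y, hy⟩ := h1
  have hya : B y α = B α y := hsymm y α
  let k : ℤ := |B y y| + 1
  have hab : B α (y + k • α) = B α y := by
    rw [map_add, map_zsmul, hiso, smul_zero, add_zero]
  have hba : B (y + k • α) α = B α y := by
    rw [hsymm, hab]
  have hbb : B (y + k • α) (y + k • α) = B y y + 2 * k * B α y := by
    simp only [map_add, map_zsmul, LinearMap.add_apply, LinearMap.smul_apply, smul_eq_mul,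
      hiso, hya]
    ring
  have hneg : B (y + k • α) (y + k • α) < 0 := by
    rw [hbb]
    have h2 : B y y < k := by
      have := le_abs_self (B y y)
      simp only [k]
      omega
    have hk : 0 < k := by
      have := abs_nonneg (B y y)
      simp only [k]
      omega
    nlinarith
  refine ⟨y + k • α, hneg, by rw [hab]; exact hy, ?_, heven _⟩
  generalize y + k • α = β at *
  have : B (α + 2 • β) (α + 2 • β) = 4 * B α y + 4 * B β β := by
    rw [two_nsmul]
    simp only [map_add, LinearMap.add_apply, hiso, hab, hba]
    ring
  rw [this]
  omega
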